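/- arXiv:1904.11227 — 3 statements merged into one kernel-verified Lean document; each statement's English description precedes it below -/
import Mathlib

section
/- Let X be a measurable space and let D_s and D_t be probability measures on X (the source and target distributions). For measurable functions f, g : X → ℝ taking values in [0,1], define the source error ε_s(f,g) = ∫ |f(x) − g(x)| dD_s(x) and the target error ε_t(f,g) = ∫ |f(x) − g(x)| dD_t(x). Let H be a set of measurable functions X → ℝ with values in [0,1], and define d_{HΔH}(D_s, D_t) = 2 · sup_{h,h' ∈ H} |ε_t(h,h') − ε_s(h,h')|. Let y_s, y_t, ŷ_t : X → ℝ be measurable functions with values in [0,1] (the true source labels, true target labels, and pseudo target labels), and set ρ = ∫ |ŷ_t(x) − y_t(x)| dD_t(x). For γ ∈ [0,1] and h ∈ H define the mixed error ε_γ(h) = γ · ε_t(h, ŷ_t) + (1−γ) · ε_s(h, y_s). Then for every h ∈ H, every γ ∈ [0,1], and every h* ∈ H, writing λ = ε_s(h*, y_s) + ε_t(h*, y_t), one has |ε_γ(h) − ε_t(h, y_t)| ≤ (1−γ) · ( (1/2) · d_{HΔH}(D_s, D_t) + λ ) + γ · ρ. -/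
open MeasureTheory

theorem integrable_of_measurable_of_mem_Icc {X : Type*} [MeasurableSpace X] (μ : Measure X)
    [IsFiniteMeasure μ] {f : X → ℝ} {a b : ℝ} (hf : Measurable f)
    (hfab : ∀ x, f x ∈ Set.Icc a b) : Integrable f μ :=
  Integrable.of_mem_Icc a b hf.aemeasurable (.of_forall hfab)

/-- Reverse triangle inequality for the `L¹` distance. -/
theorem abs_integral_abs_sub_sub_le {X : Type*} [MeasurableSpace X] {μ : Measure X}
    {f g k : X → ℝ} (hf : Integrable f μ) (hg : Integrable g μ) (hk : Integrable k μ) :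
    |(∫ x, |f x - g x| ∂μ) - ∫ x, |f x - k x| ∂μ| ≤ ∫ x, |g x - k x| ∂μ := by
  have hfg : Integrable (fun x => |f x - g x|) μ := (hf.sub hg).abs
  have hfk : Integrable (fun x => |f x - k x|) μ := (hf.sub hk).abs
  rw [← integral_sub hfg hfk]
  refine abs_integral_le_integral_abs.trans
    (integral_mono (hfg.sub hfk).abs (hg.sub hk).abs fun x => ?_)
  have := abs_abs_sub_abs_le_abs_sub (f x - g x) (f x - k x)
  rwa [sub_sub_sub_cancel_left, abs_sub_comm (k x)] at this

theorem integral_abs_sub_mem_Icc {X : Type*} [MeasurableSpace X] (μ : Measure X)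
    [IsProbabilityMeasure μ] {f g : X → ℝ} (hf : Measurable f) (hg : Measurable g)
    (hf01 : ∀ x, f x ∈ Set.Icc (0 : ℝ) 1) (hg01 : ∀ x, g x ∈ Set.Icc (0 : ℝ) 1) :
    ∫ x, |f x - g x| ∂μ ∈ Set.Icc (0 : ℝ) 1 := by
  refine ⟨integral_nonneg fun x => abs_nonneg _, ?_⟩
  have hfi := integrable_of_measurable_of_mem_Icc μ hf hf01
  have hgi := integrable_of_measurable_of_mem_Icc μ hg hg01
  have hle (x : X) : |f x - g x| ≤ 1 :=
    abs_le.2 ⟨by linarith [(hf01 x).1, (hg01 x).2], by linarith [(hf01 x).2, (hg01 x).1]⟩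
  have := integral_mono (hfi.sub hgi).abs (integrable_const (1 : ℝ)) hle
  simpa using this

theorem bddAbove_abs_integral_abs_sub_sub {X : Type*} [MeasurableSpace X] (μ ν : Measure X)
    [IsProbabilityMeasure μ] [IsProbabilityMeasure ν] {H : Set (X → ℝ)}
    (hHmeas : ∀ h ∈ H, Measurable h) (hH01 : ∀ h ∈ H, ∀ x, h x ∈ Set.Icc (0 : ℝ) 1) :
    BddAbove {r : ℝ | ∃ h1 ∈ H, ∃ h2 ∈ H,
      r = |(∫ x, |h1 x - h2 x| ∂ν) - (∫ x, |h1 x - h2 x| ∂μ)|} := by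
  refine ⟨1, ?_⟩
  rintro _ ⟨f, hf, g, hg, rfl⟩
  have hμ := integral_abs_sub_mem_Icc μ (hHmeas f hf) (hHmeas g hg) (hH01 f hf) (hH01 g hg)
  have hν := integral_abs_sub_mem_Icc ν (hHmeas f hf) (hHmeas g hg) (hH01 f hf) (hH01 g hg)
  exact abs_le.2 ⟨by linarith [hμ.2, hν.1], by linarith [hμ.1, hν.2]⟩

/-- Lemma 1 of the paper (error bound for TPN): for any hypothesis `h ∈ H`,
mixing weight `γ ∈ [0,1]`, and joint hypothesis `h* ∈ H`, the mixed error
`ε_γ(h) = γ·ε_t(h,ŷ_t) + (1−γ)·ε_s(h,y_s)` is close to the oracle target error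
`ε_t(h,y_t)`, up to `(1−γ)((1/2)·d_{HΔH}(D_s,D_t) + λ) + γ·ρ`. -/
theorem tpn_error_bound
    {X : Type*} [MeasurableSpace X]
    (Ds Dt : Measure X) [IsProbabilityMeasure Ds] [IsProbabilityMeasure Dt]
    (H : Set (X → ℝ))
    (hHmeas : ∀ h ∈ H, Measurable h)
    (hH01 : ∀ h ∈ H, ∀ x, h x ∈ Set.Icc (0 : ℝ) 1)
    (ys yt yth : X → ℝ)
    (hys : Measurable ys) (hys01 : ∀ x, ys x ∈ Set.Icc (0 : ℝ) 1)
    (hyt : Measurable yt) (hyt01 : ∀ x, yt x ∈ Set.Icc (0 : ℝ) 1)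
    (hyth : Measurable yth) (hyth01 : ∀ x, yth x ∈ Set.Icc (0 : ℝ) 1)
    (h : X → ℝ) (hh : h ∈ H)
    (γ : ℝ) (hγ : γ ∈ Set.Icc (0 : ℝ) 1)
    (hstar : X → ℝ) (hhstar : hstar ∈ H) :
    |(γ * (∫ x, |h x - yth x| ∂Dt) + (1 - γ) * (∫ x, |h x - ys x| ∂Ds))
        - ∫ x, |h x - yt x| ∂Dt|
      ≤ (1 - γ) *
          ((1 / 2) *
              (2 * sSup {r : ℝ | ∃ h1 ∈ H, ∃ h2 ∈ H,
                r = |(∫ x, |h1 x - h2 x| ∂Dt) - (∫ x, |h1 x - h2 x| ∂Ds)|})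
            + ((∫ x, |hstar x - ys x| ∂Ds) + (∫ x, |hstar x - yt x| ∂Dt)))
        + γ * (∫ x, |yth x - yt x| ∂Dt) := by
  have hsup := le_csSup (bddAbove_abs_integral_abs_sub_sub Ds Dt hHmeas hH01)
    ⟨h, hh, hstar, hhstar, rfl⟩
  have hhs := integrable_of_measurable_of_mem_Icc Ds (hHmeas h hh) (hH01 h hh)
  have hht := integrable_of_measurable_of_mem_Icc Dt (hHmeas h hh) (hH01 h hh)
  have hss := integrable_of_measurable_of_mem_Icc Ds (hHmeas _ hhstar) (hH01 _ hhstar)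
  have hst := integrable_of_measurable_of_mem_Icc Dt (hHmeas _ hhstar) (hH01 _ hhstar)
  have hyti := integrable_of_measurable_of_mem_Icc Dt hyt hyt01
  have hpseudo := abs_integral_abs_sub_sub_le hht
    (integrable_of_measurable_of_mem_Icc Dt hyth hyth01) hyti
  have hsource := abs_integral_abs_sub_sub_le hhs hss
    (integrable_of_measurable_of_mem_Icc Ds hys hys01)
  have htarget := abs_integral_abs_sub_sub_le hht hst hyti
  set S := sSup {r : ℝ | ∃ h1 ∈ H, ∃ h2 ∈ H,
    r = |(∫ x, |h1 x - h2 x| ∂Dt) - (∫ x, |h1 x - h2 x| ∂Ds)|}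
  rw [abs_le] at hsup hpseudo hsource htarget
  have hγ' : 0 ≤ 1 - γ := sub_nonneg.2 hγ.2
  have hlow := mul_le_mul_of_nonneg_left hpseudo.1 hγ.1
  have hupp := mul_le_mul_of_nonneg_left hpseudo.2 hγ.1
  have hdiff : |(∫ x, |h x - ys x| ∂Ds) - ∫ x, |h x - yt x| ∂Dt| ≤
      (1 / 2) * (2 * S) + ((∫ x, |hstar x - ys x| ∂Ds) + (∫ x, |hstar x - yt x| ∂Dt)) :=
    abs_le.2 ⟨by linarith, by linarith⟩
  rw [abs_le] at hdiff
  have hlow' := mul_le_mul_of_nonneg_left hdiff.1 hγ'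
  have hupp' := mul_le_mul_of_nonneg_left hdiff.2 hγ'
  exact abs_le.2 ⟨by linarith, by linarith⟩
end

section
/- Let X be a measurable space and let D_s and D_t be probability measures on X. For measurable functions f, g : X → ℝ taking values in [0,1], define ε_s(f,g) = ∫ |f − g| dD_s and ε_t(f,g) = ∫ |f − g| dD_t. Let H be a nonempty set of measurable functions X → ℝ with values in [0,1], define d_{HΔH}(D_s, D_t) = 2 · sup_{h,h' ∈ H} |ε_t(h,h') − ε_s(h,h')|, and let λ = inf_{h' ∈ H} ( ε_s(h', y_s) + ε_t(h', y_t) ), where y_s, y_t, ŷ_t : X → ℝ are measurable with values in [0,1] and ρ = ∫ |ŷ_t − y_t| dD_t. For γ ∈ [0,1] and h ∈ H define ε_γ(h) = γ · ε_t(h, ŷ_t) + (1−γ) · ε_s(h, y_s). Then for every h ∈ H and every γ ∈ [0,1], |ε_γ(h) − ε_t(h, y_t)| ≤ (1−γ) · ( (1/2) · d_{HΔH}(D_s, D_t) + λ ) + γ · ρ. -/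
open MeasureTheory

theorem integrable_of_mem_Icc_zero_one {X : Type*} [MeasurableSpace X] {μ : Measure X}
    [IsFiniteMeasure μ] {f : X → ℝ} (hf : Measurable f) (hf01 : ∀ x, f x ∈ Set.Icc (0 : ℝ) 1) :
    Integrable f μ :=
  Integrable.of_mem_Icc 0 1 hf.aemeasurable (.of_forall hf01)

theorem integral_abs_sub_mem_Icc_zero_one {X : Type*} [MeasurableSpace X] {μ : Measure X}
    [IsProbabilityMeasure μ] {f g : X → ℝ} (hf : Measurable f) (hg : Measurable g)
    (hf01 : ∀ x, f x ∈ Set.Icc (0 : ℝ) 1) (hg01 : ∀ x, g x ∈ Set.Icc (0 : ℝ) 1) :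
    ∫ x, |f x - g x| ∂μ ∈ Set.Icc (0 : ℝ) 1 := by
  refine ⟨integral_nonneg fun x => abs_nonneg _, ?_⟩
  have hfg : Integrable (fun x => |f x - g x|) μ :=
    ((integrable_of_mem_Icc_zero_one hf hf01).sub (integrable_of_mem_Icc_zero_one hg hg01)).abs
  calc ∫ x, |f x - g x| ∂μ ≤ ∫ _, (1 : ℝ) ∂μ :=
        integral_mono hfg (integrable_const 1) fun x =>
          (abs_sub_le_of_le_of_le (hf01 x).1 (hf01 x).2 (hg01 x).1 (hg01 x).2).trans_eq (sub_zero 1)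
    _ = 1 := by simp

/-- Lemma 1 with `λ` taken as the infimum of the combined error of the joint
ideal hypothesis: for every `h ∈ H` and `γ ∈ [0,1]`,
`|ε_γ(h) − ε_t(h,y_t)| ≤ (1−γ)((1/2)·d_{HΔH}(D_s,D_t) + λ) + γ·ρ`. -/
theorem tpn_error_bound_inf
    {X : Type*} [MeasurableSpace X]
    (Ds Dt : Measure X) [IsProbabilityMeasure Ds] [IsProbabilityMeasure Dt]
    (H : Set (X → ℝ)) (hHne : H.Nonempty)
    (hHmeas : ∀ h ∈ H, Measurable h)
    (hH01 : ∀ h ∈ H, ∀ x, h x ∈ Set.Icc (0 : ℝ) 1)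
    (ys yt yth : X → ℝ)
    (hys : Measurable ys) (hys01 : ∀ x, ys x ∈ Set.Icc (0 : ℝ) 1)
    (hyt : Measurable yt) (hyt01 : ∀ x, yt x ∈ Set.Icc (0 : ℝ) 1)
    (hyth : Measurable yth) (hyth01 : ∀ x, yth x ∈ Set.Icc (0 : ℝ) 1)
    (h : X → ℝ) (hh : h ∈ H)
    (γ : ℝ) (hγ : γ ∈ Set.Icc (0 : ℝ) 1) :
    |(γ * (∫ x, |h x - yth x| ∂Dt) + (1 - γ) * (∫ x, |h x - ys x| ∂Ds))
        - ∫ x, |h x - yt x| ∂Dt|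
      ≤ (1 - γ) *
          ((1 / 2) *
              (2 * sSup {r : ℝ | ∃ h1 ∈ H, ∃ h2 ∈ H,
                r = |(∫ x, |h1 x - h2 x| ∂Dt) - (∫ x, |h1 x - h2 x| ∂Ds)|})
            + sInf {r : ℝ | ∃ h' ∈ H,
                r = (∫ x, |h' x - ys x| ∂Ds) + (∫ x, |h' x - yt x| ∂Dt)})
        + γ * (∫ x, |yth x - yt x| ∂Dt) := by
  set S := sSup {r : ℝ | ∃ h1 ∈ H, ∃ h2 ∈ H,
    r = |(∫ x, |h1 x - h2 x| ∂Dt) - (∫ x, |h1 x - h2 x| ∂Ds)|}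
  set L := sInf {r : ℝ | ∃ h' ∈ H,
    r = (∫ x, |h' x - ys x| ∂Ds) + (∫ x, |h' x - yt x| ∂Dt)}
  have discrepancy_le : ∀ h' ∈ H,
      |(∫ x, |h x - h' x| ∂Dt) - ∫ x, |h x - h' x| ∂Ds| ≤ S := by
    intro h' hh'
    refine le_csSup ⟨1, ?_⟩ ⟨h, hh, h', hh', rfl⟩
    rintro r ⟨h1, hh1, h2, hh2, rfl⟩
    have ht := integral_abs_sub_mem_Icc_zero_one (μ := Dt) (hHmeas h1 hh1) (hHmeas h2 hh2)
      (hH01 h1 hh1) (hH01 h2 hh2)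
    have hs := integral_abs_sub_mem_Icc_zero_one (μ := Ds) (hHmeas h1 hh1) (hHmeas h2 hh2)
      (hH01 h1 hh1) (hH01 h2 hh2)
    rw [abs_le]
    constructor <;> linarith [ht.1, ht.2, hs.1, hs.2]
  have int_H : ∀ h' ∈ H, ∀ μ : Measure X, IsProbabilityMeasure μ → Integrable h' μ :=
    fun h' hh' μ _ => integrable_of_mem_Icc_zero_one (hHmeas h' hh') (hH01 h' hh')
  have int_yt : Integrable yt Dt := integrable_of_mem_Icc_zero_one hyt hyt01
  have shift : |(∫ x, |h x - ys x| ∂Ds) - ∫ x, |h x - yt x| ∂Dt| ≤ S + L := by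
    rw [← sub_le_iff_le_add']
    refine le_csInf (hHne.elim fun h' hh' => ⟨_, h', hh', rfl⟩) ?_
    rintro r ⟨h', hh', rfl⟩
    have hs := abs_integral_abs_sub_sub_le (int_H h hh Ds inferInstance)
      (int_H h' hh' Ds inferInstance) (integrable_of_mem_Icc_zero_one hys hys01)
    have ht := abs_integral_abs_sub_sub_le (int_H h hh Dt inferInstance)
      (int_H h' hh' Dt inferInstance) int_yt
    have hd := discrepancy_le h' hh'
    rw [abs_le] at hs ht hd
    rw [sub_le_iff_le_add', abs_le]
    constructor <;> linarith [hs.1, hs.2, ht.1, ht.2, hd.1, hd.2]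
  have pseudo := abs_integral_abs_sub_sub_le (int_H h hh Dt inferInstance)
    (integrable_of_mem_Icc_zero_one hyth hyth01) int_yt
  rw [abs_le] at shift pseudo ⊢
  have hγ' := sub_nonneg.2 hγ.2
  constructor
  · linarith [mul_le_mul_of_nonneg_left shift.1 hγ', mul_le_mul_of_nonneg_left pseudo.1 hγ.1]
  · linarith [mul_le_mul_of_nonneg_left shift.2 hγ', mul_le_mul_of_nonneg_left pseudo.2 hγ.1]
end

section
/- Let X be a measurable space and let D_s and D_t be probability measures on X. For measurable functions f, g : X → ℝ taking values in [0,1], define ε_s(f,g) = ∫ |f − g| dD_s and ε_t(f,g) = ∫ |f − g| dD_t. Let H be a set of measurable functions X → ℝ with values in [0,1] and define d_{HΔH}(D_s, D_t) = 2 · sup_{h,h' ∈ H} |ε_t(h,h') − ε_s(h,h')|. Let y_s, y_t, ŷ_t : X → ℝ be measurable with values in [0,1], set ρ = ∫ |ŷ_t − y_t| dD_t, and for γ ∈ [0,1] define ε_γ(h) = γ · ε_t(h, ŷ_t) + (1−γ) · ε_s(h, y_s). Then for every h ∈ H, every γ ∈ [0,1], and every h* ∈ H, writing λ = ε_s(h*,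 y_s) + ε_t(h*, y_t), the true target error is bounded as ε_t(h, y_t) ≤ ε_γ(h) + (1−γ) · ( (1/2) · d_{HΔH}(D_s, D_t) + λ ) + γ · ρ. -/
open MeasureTheory

section UnitIntervalValued

variable {X : Type*} [MeasurableSpace X] (μ : Measure X) [IsProbabilityMeasure μ] {f g : X → ℝ}

theorem integrable_of_measurable_of_mem_unitInterval (hf : Measurable f)
    (hf01 : ∀ x, f x ∈ Set.Icc (0 : ℝ) 1) : Integrable f μ :=
  .of_mem_Icc 0 1 hf.aemeasurable (.of_forall hf01)

theorem integral_abs_sub_mem_unitInterval (hf : Measurable f) (hg : Measurable g)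
    (hf01 : ∀ x, f x ∈ Set.Icc (0 : ℝ) 1) (hg01 : ∀ x, g x ∈ Set.Icc (0 : ℝ) 1) :
    ∫ x, |f x - g x| ∂μ ∈ Set.Icc (0 : ℝ) 1 := by
  refine ⟨integral_nonneg fun x => abs_nonneg _, ?_⟩
  have hint : Integrable (fun x => |f x - g x|) μ :=
    ((integrable_of_measurable_of_mem_unitInterval μ hf hf01).sub
      (integrable_of_measurable_of_mem_unitInterval μ hg hg01)).abs
  calc ∫ x, |f x - g x| ∂μ ≤ ∫ _, (1 : ℝ) ∂μ :=
        integral_mono hint (integrable_const 1) fun x =>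
          abs_sub_le_of_nonneg_of_le (hf01 x).1 (hf01 x).2 (hg01 x).1 (hg01 x).2
    _ = 1 := by simp

end UnitIntervalValued

theorem integral_abs_sub_comm {X : Type*} [MeasurableSpace X] (μ : Measure X) (f g : X → ℝ) :
    ∫ x, |f x - g x| ∂μ = ∫ x, |g x - f x| ∂μ := by
  simp only [abs_sub_comm]

theorem integral_abs_sub_le_add {X : Type*} [MeasurableSpace X] {μ : Measure X} {f g k : X → ℝ}
    (hf : Integrable f μ) (hg : Integrable g μ) (hk : Integrable k μ) :
    ∫ x, |f x - k x| ∂μ ≤ (∫ x, |f x - g x| ∂μ) + ∫ x, |g x - k x| ∂μ := by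
  have hfg : Integrable (fun x => |f x - g x|) μ := (hf.sub hg).abs
  have hgk : Integrable (fun x => |g x - k x|) μ := (hg.sub hk).abs
  rw [← integral_add hfg hgk]
  exact integral_mono (hf.sub hk).abs (hfg.add hgk) fun x => abs_sub_le _ _ _

/-- One-sided consequence of Lemma 1: the true target error is bounded by the
mixed error plus `(1−γ)((1/2)·d_{HΔH}(D_s,D_t) + λ) + γ·ρ`. -/
theorem target_error_le_mixed_error_bound
    {X : Type*} [MeasurableSpace X]
    (Ds Dt : Measure X) [IsProbabilityMeasure Ds] [IsProbabilityMeasure Dt]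
    (H : Set (X → ℝ))
    (hHmeas : ∀ h ∈ H, Measurable h)
    (hH01 : ∀ h ∈ H, ∀ x, h x ∈ Set.Icc (0 : ℝ) 1)
    (ys yt yth : X → ℝ)
    (hys : Measurable ys) (hys01 : ∀ x, ys x ∈ Set.Icc (0 : ℝ) 1)
    (hyt : Measurable yt) (hyt01 : ∀ x, yt x ∈ Set.Icc (0 : ℝ) 1)
    (hyth : Measurable yth) (hyth01 : ∀ x, yth x ∈ Set.Icc (0 : ℝ) 1)
    (h : X → ℝ) (hh : h ∈ H)
    (γ : ℝ) (hγ : γ ∈ Set.Icc (0 : ℝ) 1)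
    (hstar : X → ℝ) (hhstar : hstar ∈ H) :
    (∫ x, |h x - yt x| ∂Dt)
      ≤ (γ * (∫ x, |h x - yth x| ∂Dt) + (1 - γ) * (∫ x, |h x - ys x| ∂Ds))
        + (1 - γ) *
            ((1 / 2) *
                (2 * sSup {r : ℝ | ∃ h1 ∈ H, ∃ h2 ∈ H,
                  r = |(∫ x, |h1 x - h2 x| ∂Dt) - (∫ x, |h1 x - h2 x| ∂Ds)|})
              + ((∫ x, |hstar x - ys x| ∂Ds) + (∫ x, |hstar x - yt x| ∂Dt)))
        + γ * (∫ x, |yth x - yt x| ∂Dt) := by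
  have hint {μ : Measure X} [IsProbabilityMeasure μ] {f : X → ℝ} (hf : f ∈ H) : Integrable f μ :=
    integrable_of_measurable_of_mem_unitInterval μ (hHmeas f hf) (hH01 f hf)
  have hyt_int := integrable_of_measurable_of_mem_unitInterval Dt hyt hyt01
  have hyth_int := integrable_of_measurable_of_mem_unitInterval Dt hyth hyth01
  have hys_int := integrable_of_measurable_of_mem_unitInterval Ds hys hys01
  have h_pseudo := integral_abs_sub_le_add (hint hh) hyth_int hyt_int
  have h_target := integral_abs_sub_le_add (hint hh) (hint hhstar) hyt_int
  have h_source := integral_abs_sub_le_add (hint hh) hys_int (hint hhstar)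
  rw [integral_abs_sub_comm Ds ys hstar] at h_source
  set S := {r : ℝ | ∃ h1 ∈ H, ∃ h2 ∈ H,
    r = |(∫ x, |h1 x - h2 x| ∂Dt) - (∫ x, |h1 x - h2 x| ∂Ds)|}
  have hS : BddAbove S := by
    refine ⟨1, ?_⟩
    rintro r ⟨f, hf, g, hg, rfl⟩
    have ht := integral_abs_sub_mem_unitInterval Dt (hHmeas f hf) (hHmeas g hg)
      (hH01 f hf) (hH01 g hg)
    have hs := integral_abs_sub_mem_unitInterval Ds (hHmeas f hf) (hHmeas g hg)
      (hH01 f hf) (hH01 g hg)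
    exact abs_sub_le_of_nonneg_of_le ht.1 ht.2 hs.1 hs.2
  have h_shift := (le_abs_self _).trans (le_csSup hS ⟨h, hh, hstar, hhstar, rfl⟩)
  have h_adapt : ∫ x, |h x - yt x| ∂Dt ≤ (∫ x, |h x - ys x| ∂Ds) + (sSup S +
      ((∫ x, |hstar x - ys x| ∂Ds) + ∫ x, |hstar x - yt x| ∂Dt)) := by
    linarith
  have h_pseudo' := mul_le_mul_of_nonneg_left h_pseudo hγ.1
  have h_adapt' := mul_le_mul_of_nonneg_left h_adapt (sub_nonneg.2 hγ.2)
  linarith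
end
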